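/- arXiv:math/0209114 — 4 statements merged into one kernel-verified Lean document; each statement's English description precedes it below -/
import Mathlib

section
/- Let R be a commutative ring, let n ≥ 1, and let U and N be n×n matrices over R such that the product of any two entries of N is zero (N_{i,j}·N_{k,l} = 0 for all i,j,k,l). Then det(U + N) = det(U) + trace(adjugate(U) · N); equivalently, det(U + N) = det(U) + Σ_{i,j} N_{i,j} · C_{i,j}(U), where C_{i,j}(U) = (−1)^{i+j} times the determinant of the matrix obtained from U by deleting row i and column j, which equals the (j,i) entry of the adjugate of U. -/
open Finset in
/-- A determinant whose rows indexed by `s` come from `N` vanishes if `s` has at least two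
elements and all products of two entries of `N` are zero. -/
lemma Matrix.det_piecewise_eq_zero {ι R : Type*} [Fintype ι] [DecidableEq ι] [CommRing R]
    (U N : Matrix ι ι R) (hN : ∀ i j k l, N i j * N k l = 0) (s : Finset ι) (hs : 1 < #s) :
    (Matrix.of (s.piecewise N.row U.row)).det = 0 := by
  obtain ⟨a, ha, b, hb, hab⟩ := one_lt_card.mp hs
  rw [← Matrix.det_transpose, Matrix.det_apply]
  refine sum_eq_zero fun σ _ => ?_
  have hprod : ∏ i, (Matrix.of (s.piecewise N.row U.row)).transpose (σ i) i = 0 := by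
    rw [← mul_prod_erase univ _ (mem_univ a),
      ← mul_prod_erase (univ.erase a) _ (mem_erase.mpr ⟨hab.symm, mem_univ b⟩), ← mul_assoc]
    simp [Matrix.transpose_apply, piecewise_eq_of_mem, ha, hb, hN]
  rw [hprod, smul_zero]

/-- The expansion of a determinant along a replaced row. -/
lemma Matrix.det_updateRow_eq_sum_mul_adjugate {ι R : Type*} [Fintype ι] [DecidableEq ι]
    [CommRing R] (U : Matrix ι ι R) (i : ι) (v : ι → R) :
    (U.updateRow i v).det = ∑ j, v j * U.adjugate j i := by
  rw [← Matrix.cramer_transpose_apply, Matrix.cramer_eq_adjugate_mulVec,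
    ← Matrix.adjugate_transpose]
  simp [Matrix.mulVec, dotProduct, mul_comm]


/-- First-order determinant expansion (proof of Lemma 2.16): if every product of two
entries of `N` vanishes, then `det (U + N) = det U + trace (adjugate U * N)`;
equivalently `det (U + N) = det U + ∑ i j, N i j * C i j (U)`, where the `(i,j)`
cofactor `C i j (U)` is the `(j,i)` entry of the adjugate of `U`. -/
theorem det_add_eq_det_add_trace_adjugate_mul {R : Type*} [CommRing R] {n : ℕ} (hn : 1 ≤ n)
    (U N : Matrix (Fin n) (Fin n) R)
    (hN : ∀ i j k l : Fin n, N i j * N k l = 0) :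
    (U + N).det = U.det + Matrix.trace (U.adjugate * N) ∧
    (U + N).det = U.det + ∑ i : Fin n, ∑ j : Fin n, N i j * U.adjugate j i := by
  have key : (U + N).det = U.det + ∑ i, ∑ j, N i j * U.adjugate j i := by
    have h := (Matrix.detRowAlternating (n := Fin n) (R := R)).toMultilinearMap
      |>.map_add_eq_map_add_linearDeriv_add U.row N.row
    have hlin := (Matrix.detRowAlternating (n := Fin n) (R := R)).toMultilinearMap
      |>.linearDeriv_apply U.row N.row
    have hrest : ∑ s : Finset (Fin n) with 2 ≤ s.card,
        (Matrix.detRowAlternating (n := Fin n) (R := R)).toMultilinearMap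
          (s.piecewise N.row U.row) = 0 :=
      Finset.sum_eq_zero fun s hs =>
        U.det_piecewise_eq_zero N hN s (Finset.mem_filter.mp hs).2
    refine (h.trans (congrArg₂ (· + ·) (congrArg _ hlin) hrest)).trans ((add_zero _).trans ?_)
    exact congrArg (U.det + ·) (Finset.sum_congr rfl fun i _ =>
      U.det_updateRow_eq_sum_mul_adjugate i (N i))
  refine ⟨?_, key⟩
  rw [key, Matrix.trace_mul_comm]
  simp [Matrix.trace, Matrix.mul_apply]
end

section
/- Let R be a commutative ring, n ≥ 1, and Y_1,…,Y_n ∈ R. Let U = U_n(Y_1,…,Y_n) be the n×n lower-triangular Toeplitz matrix with (i,j) entry Y_{i−j+1} when i ≥ j and 0 when i < j. Let N be an n×n matrix over R such that the product of any two entries of N is zero (N_{i,j}·N_{k,l} = 0 for all i,j,k,l). Then det(U + N) = Y_1^n + Σ_{k=1}^{n} (Tr_{k−1} N) · C_{1,k}(U), where Tr_m N := Σ_{i=1}^{n−m} N_{i,i+m} is the sum of the entries on the m-th superdiagonal of N (with Tr_m N := 0 for m ≥ n), and C_{1,k}(U) is the (1,k) cofactor of U, i.e. the (k,1) entry of the adjugate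 of U. -/
/-- The `n × n` lower-triangular Toeplitz matrix with `(i,j)` entry `Y (i - j + 1)`
(one-based value index) when `i ≥ j` and `0` otherwise; here `Y m` denotes `Y_m`. -/
def lowerToeplitz {R : Type*} [CommRing R] (n : ℕ) (Y : ℕ → R) :
    Matrix (Fin n) (Fin n) R :=
  Matrix.of fun i j => if (j : ℕ) ≤ (i : ℕ) then Y ((i : ℕ) - (j : ℕ) + 1) else 0

/-- `Tr_m N`: the sum of the entries on the `m`-th superdiagonal of `N`
(`Tr_0` is the trace; `Tr_m N = 0` for `m ≥ s`). -/
def trSuper {R : Type*} [CommRing R] {s : ℕ} (N : Matrix (Fin s) (Fin s) R) (m : ℕ) : R :=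
  ∑ i : Fin s, if h : (i : ℕ) + m < s then N i ⟨(i : ℕ) + m, h⟩ else 0

/-- A product of sums `f i + g i` is affine in `g` when the pairwise products of the values of `g`
vanish. -/
theorem Finset.prod_add_of_mul_eq_zero {ι R : Type*} [DecidableEq ι] [CommRing R] (s : Finset ι)
    (f g : ι → R) (hg : ∀ i j, g i * g j = 0) :
    ∏ i ∈ s, (f i + g i) = ∏ i ∈ s, f i + ∑ i ∈ s, g i * ∏ j ∈ s.erase i, f j := by
  induction s using Finset.induction_on with
  | empty => simp
  | insert a s ha ih =>
    have hcross : g a * ∑ i ∈ s, g i * ∏ j ∈ s.erase i, f j = 0 := by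
      simp [Finset.mul_sum, ← mul_assoc, hg]
    have hsum : ∑ i ∈ s, g i * ∏ j ∈ (insert a s).erase i, f j =
        f a * ∑ i ∈ s, g i * ∏ j ∈ s.erase i, f j := by
      rw [Finset.mul_sum]
      refine Finset.sum_congr rfl fun i hi => ?_
      have hia : a ≠ i := fun h => ha (h ▸ hi)
      rw [Finset.erase_insert_of_ne hia, Finset.prod_insert (by simp [ha])]
      ring
    rw [Finset.prod_insert ha, Finset.prod_insert ha, Finset.sum_insert ha,
      Finset.erase_insert ha, hsum, ih]
    linear_combination hcross

/-- First-order expansion of the determinant at `A` in a direction `N` whose entries have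
vanishing pairwise products. -/
theorem Matrix.det_add_of_mul_eq_zero {m R : Type*} [Fintype m] [DecidableEq m] [CommRing R]
    (A N : Matrix m m R) (hN : ∀ i j k l, N i j * N k l = 0) :
    (A + N).det = A.det + (A.adjugate * N).trace := by
  have hcol (i : m) : (A.adjugate * N) i i = (A.updateCol i fun k => N k i).det := by
    rw [← Matrix.cramer_apply, Matrix.cramer_eq_adjugate_mulVec]
    rfl
  have hprod (σ : Equiv.Perm m) (i : m) :
      ∏ j, A.updateCol i (fun k => N k i) (σ j) j =
        N (σ i) i * ∏ j ∈ Finset.univ.erase i, A (σ j) j := by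
    rw [← Finset.mul_prod_erase _ _ (Finset.mem_univ i)]
    congr 1
    · simp
    · refine Finset.prod_congr rfl fun j hj => ?_
      rw [Matrix.updateCol_ne (Finset.ne_of_mem_erase hj)]
  simp only [Matrix.trace, Matrix.diag_apply, hcol, Matrix.det_apply, hprod, Matrix.add_apply]
  rw [Finset.sum_comm, ← Finset.sum_add_distrib]
  refine Finset.sum_congr rfl fun σ _ => ?_
  rw [Finset.prod_add_of_mul_eq_zero _ _ _ fun i j => hN _ _ _ _, smul_add, Finset.smul_sum]

theorem Matrix.adjugate_mul_comm_of_isLeftRegular_det {m R : Type*} [Fintype m] [DecidableEq m]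
    [CommRing R] {A B : Matrix m m R} (hA : IsLeftRegular A.det) (h : A * B = B * A) :
    A.adjugate * B = B * A.adjugate := by
  refine (Matrix.isRegular_of_isLeftRegular_det hA).left ?_
  change A * (A.adjugate * B) = A * (B * A.adjugate)
  rw [← Matrix.mul_assoc, ← Matrix.mul_assoc, h, Matrix.mul_assoc B, Matrix.mul_adjugate]
  simp

/-- Every matrix that commutes with `A` commutes with the adjugate of `A`. -/
theorem Matrix.adjugate_mul_comm {m R : Type*} [Fintype m] [DecidableEq m] [CommRing R]
    {A B : Matrix m m R} (h : A * B = B * A) : A.adjugate * B = B * A.adjugate := by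
  let A' : Matrix m m (Polynomial R) := (Polynomial.X : Polynomial R) • 1 + A.map Polynomial.C
  let B' : Matrix m m (Polynomial R) := Polynomial.C.mapMatrix B
  let ev : Matrix m m (Polynomial R) →+* Matrix m m R := (Polynomial.evalRingHom 0).mapMatrix
  have hA' : ev A' = A := by
    ext
    simp [ev, A']
  have hB' : ev B' = B := by
    ext
    simp [ev, B']
  have hreg : IsRegular A'.det :=
    Polynomial.Monic.isRegular (Polynomial.leadingCoeff_det_X_one_add_C A)
  have hcomm : A' * B' = B' * A' := by
    have hmap : A.map Polynomial.C * B' = B' * A.map Polynomial.C := by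
      change Polynomial.C.mapMatrix A * _ = _ * Polynomial.C.mapMatrix A
      rw [← map_mul, ← map_mul, h]
    simp only [A', Matrix.add_mul, Matrix.mul_add, hmap]
    simp
  have hadj := congrArg ev (Matrix.adjugate_mul_comm_of_isLeftRegular_det hreg.left hcomm)
  have hev : ev A'.adjugate = A.adjugate := by
    rw [RingHom.map_adjugate]
    exact congrArg _ hA'
  rwa [map_mul, map_mul, hev, hB'] at hadj

/-- The matrix with ones on the first subdiagonal. -/
def lowerShift (R : Type*) [CommRing R] (n : ℕ) : Matrix (Fin n) (Fin n) R :=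
  Matrix.of fun i j => if (i : ℕ) = j + 1 then 1 else 0

theorem mul_lowerShift_apply {R : Type*} [CommRing R] {n : ℕ} (A : Matrix (Fin n) (Fin n) R)
    (i j : Fin n) :
    (A * lowerShift R n) i j = if h : (j : ℕ) + 1 < n then A i ⟨j + 1, h⟩ else 0 := by
  simp only [Matrix.mul_apply, lowerShift, Matrix.of_apply, mul_ite, mul_one, mul_zero]
  split_ifs with h
  · rw [Finset.sum_eq_single ⟨j + 1, h⟩]
    · simp
    · exact fun k _ hk => if_neg fun hkj => hk (Fin.ext hkj)
    · simp
  · exact Finset.sum_eq_zero fun k _ => if_neg (by omega)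

theorem lowerShift_mul_apply {R : Type*} [CommRing R] {n : ℕ} (A : Matrix (Fin n) (Fin n) R)
    (i j : Fin n) :
    (lowerShift R n * A) i j = if 0 < (i : ℕ) then A ⟨i - 1, by omega⟩ j else 0 := by
  simp only [Matrix.mul_apply, lowerShift, Matrix.of_apply, ite_mul, one_mul, zero_mul]
  split_ifs with h
  · rw [Finset.sum_eq_single ⟨i - 1, by omega⟩]
    · exact if_pos (by simp; omega)
    · intro k _ hk
      rw [Ne, Fin.ext_iff] at hk
      exact if_neg (by simp at hk; omega)
    · simp
  · exact Finset.sum_eq_zero fun k _ => if_neg (by omega)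

theorem lowerToeplitz_mul_lowerShift {R : Type*} [CommRing R] (n : ℕ) (Y : ℕ → R) :
    lowerToeplitz n Y * lowerShift R n = lowerShift R n * lowerToeplitz n Y := by
  ext i j
  rw [mul_lowerShift_apply, lowerShift_mul_apply]
  have := i.isLt
  simp only [lowerToeplitz, Matrix.of_apply]
  split_ifs <;> first | rfl | omega | (congr 1; omega)

/-- A matrix commuting with the lower shift is lower-triangular Toeplitz, with entries read off
from its first column. -/
theorem apply_of_mul_lowerShift_comm {R : Type*} [CommRing R] {n : ℕ} (hn : 0 < n)
    {A : Matrix (Fin n) (Fin n) R} (h : A * lowerShift R n = lowerShift R n * A) (i j : Fin n) :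
    A i j = if (j : ℕ) ≤ i then A ⟨i - j, by omega⟩ ⟨0, hn⟩ else 0 := by
  obtain ⟨j, hj⟩ := j
  induction j generalizing i with
  | zero => simp
  | succ j ih =>
    have hij := congrFun (congrFun h i) ⟨j, by omega⟩
    rw [mul_lowerShift_apply, lowerShift_mul_apply, dif_pos hj] at hij
    rw [hij]
    split_ifs with h0 h1 h1
    · rw [ih, if_pos (by simp at h1 ⊢; omega)]
      congr 1
      simp; omega
    · rw [ih, if_neg (by simp at h1 ⊢; omega)]
    · simp at h1; omega
    · rfl

theorem det_lowerToeplitz {R : Type*} [CommRing R] (n : ℕ) (Y : ℕ → R) :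
    (lowerToeplitz n Y).det = Y 1 ^ n := by
  rw [Matrix.det_of_isLowerTriangular]
  · simp [lowerToeplitz]
  · intro i j hij
    exact if_neg (by simpa using hij)

/-- Lemma 2.16(1): for the lower-triangular Toeplitz matrix `U = U_n(Y_1, …, Y_n)` and a
matrix `N` all of whose products of two entries vanish,
`det (U + N) = Y_1 ^ n + ∑_{k=1}^n (Tr_{k-1} N) · C_{1,k}(U)`, where `C_{1,k}(U)` is the
`(1,k)` cofactor of `U`, i.e. the `(k,1)` entry of the adjugate of `U`. -/
theorem det_lowerToeplitz_add {R : Type*} [CommRing R] (n : ℕ) (hn : 0 < n) (Y : ℕ → R)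
    (N : Matrix (Fin n) (Fin n) R)
    (hN : ∀ i j k l : Fin n, N i j * N k l = 0) :
    (lowerToeplitz n Y + N).det
      = Y 1 ^ n + ∑ k : Fin n,
          trSuper N (k : ℕ) * (lowerToeplitz n Y).adjugate k ⟨0, hn⟩ := by
  have hadj := apply_of_mul_lowerShift_comm hn
    (Matrix.adjugate_mul_comm (lowerToeplitz_mul_lowerShift n Y))
  rw [Matrix.det_add_of_mul_eq_zero _ _ hN, det_lowerToeplitz]
  congr 1
  set C := (lowerToeplitz n Y).adjugate
  simp only [Matrix.trace, Matrix.diag_apply, Matrix.mul_apply, trSuper, Finset.sum_mul]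
  rw [Finset.sum_comm, Finset.sum_comm (f := fun k i : Fin n => _ * C k ⟨0, hn⟩)]
  refine Finset.sum_congr rfl fun k _ => ?_
  refine Finset.sum_bij_ne_zero (fun i _ _ => ⟨i - k, by omega⟩) (fun _ _ _ => Finset.mem_univ _)
    ?_ ?_ ?_
  · intro i _ hi j _ hj hij
    rw [hadj] at hi hj
    have hki : (k : ℕ) ≤ i := by
      by_contra hlt
      simp [hlt] at hi
    have hkj : (k : ℕ) ≤ j := by
      by_contra hlt
      simp [hlt] at hj
    rw [Fin.mk.injEq] at hij
    exact Fin.ext (by omega)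
  · intro m _ hm
    have hlt : (k : ℕ) + m < n := by
      by_contra hge
      simp [hge] at hm
    refine ⟨⟨k + m, hlt⟩, Finset.mem_univ _, ?_, Fin.ext (by simp)⟩
    rw [hadj]
    rw [dif_pos hlt, mul_comm] at hm
    simpa using hm
  · intro i _ hi
    rw [hadj] at hi
    have hki : (k : ℕ) ≤ i := by
      by_contra hlt
      simp [hlt] at hi
    rw [hadj, if_pos hki, mul_comm]
    simp [Nat.add_sub_cancel' hki]
end

section
/- Let R be a commutative ring, n ≥ 1, Y_1,…,Y_n ∈ R, and let U = U_n(Y_1,…,Y_n) be the n×n lower-triangular Toeplitz matrix with (i,j) entry Y_{i−j+1} when i ≥ j and 0 when i < j. Then: (a) the (i,j) cofactor C_{i,j}(U) vanishes whenever i > j; and (b) for all 1 ≤ i ≤ n−1 and 1 ≤ j ≤ n−1, C_{i,j}(U) = C_{i+1,j+1}(U). Here C_{i,j}(U) := (−1)^{i+j} times the determinant of the matrix obtained by deleting row i and column j of U, equivalently the (j,i) entry of the adjugate of U. -/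
namespace Matrix

theorem commute_adjugate_of_isLeftRegular_det {ι R : Type*} [Fintype ι] [DecidableEq ι]
    [CommRing R] {A B : Matrix ι ι R} (hA : IsLeftRegular A.det) (h : Commute A B) :
    Commute A.adjugate B := by
  have key : A.det • (A.adjugate * B) = A.det • (B * A.adjugate) := by
    calc A.det • (A.adjugate * B) = A.adjugate * (B * A) * A.adjugate := by
          rw [mul_assoc, mul_assoc, mul_adjugate]; simp
      _ = A.adjugate * (A * B) * A.adjugate := by rw [h.eq]
      _ = A.det • (B * A.adjugate) := by
          rw [← mul_assoc, adjugate_mul]; simp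
  ext i j
  exact hA (by simpa using congr_fun₂ key i j)

/-- A matrix commuting with `A` commutes with the adjugate of `A`. The determinant of
`A + X` is monic, which reduces the claim to the case of a regular determinant. -/
theorem commute_adjugate {ι R : Type*} [Fintype ι] [DecidableEq ι] [CommRing R]
    {A B : Matrix ι ι R} (h : Commute A B) : Commute A.adjugate B := by
  let g : Matrix ι ι R → Matrix ι ι (Polynomial R) := fun M =>
    M.map Polynomial.C + (Polynomial.X : Polynomial R) • 1
  let f : Matrix ι ι (Polynomial R) →+* Matrix ι ι R := (Polynomial.evalRingHom 0).mapMatrix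
  have f_map : ∀ M : Matrix ι ι R, f (M.map Polynomial.C) = M := fun M => by
    ext; simp [f]
  have f_g : f (g A) = A := by
    ext; simp [f, g]
  have det_regular : IsLeftRegular (g A).det := by
    refine (Polynomial.Monic.isRegular ?_).left
    simp only [g, Polynomial.Monic.def, ← Polynomial.leadingCoeff_det_X_one_add_C A, add_comm]
  have hg : Commute (g A) (B.map Polynomial.C) := by
    refine Commute.add_left ?_ ((Commute.one_left _).smul_left _)
    simpa using h.map (Polynomial.C : R →+* Polynomial R).mapMatrix
  have hf := (commute_adjugate_of_isLeftRegular_det det_regular hg).map f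
  rwa [f_map, RingHom.map_adjugate, f_g] at hf

/-- The nilpotent matrix with ones on the first subdiagonal and zeros elsewhere. -/
def lowerShift (R : Type*) [CommRing R] (n : ℕ) : Matrix (Fin n) (Fin n) R :=
  of fun i j => if (i : ℕ) = j + 1 then 1 else 0

section lowerShift

variable {R : Type*} [CommRing R] {n : ℕ}

theorem lowerShift_mul_apply_succ (M : Matrix (Fin n) (Fin n) R) (i k : Fin n)
    (hi : (i : ℕ) + 1 < n) : (lowerShift R n * M) ⟨i + 1, hi⟩ k = M i k := by
  rw [mul_apply, Finset.sum_eq_single i]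
  · simp [lowerShift]
  · intro b _ hb
    simp [lowerShift, Fin.val_inj, hb.symm]
  · simp

theorem lowerShift_mul_apply_zero (M : Matrix (Fin n) (Fin n) R) (i k : Fin n)
    (hi : (i : ℕ) = 0) : (lowerShift R n * M) i k = 0 := by
  simp [mul_apply, lowerShift, hi]

theorem mul_lowerShift_apply (M : Matrix (Fin n) (Fin n) R) (i k : Fin n)
    (hk : (k : ℕ) + 1 < n) : (M * lowerShift R n) i k = M i ⟨k + 1, hk⟩ := by
  rw [mul_apply, Finset.sum_eq_single ⟨k + 1, hk⟩]
  · simp [lowerShift]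
  · intro b _ hb
    simp [lowerShift, show (b : ℕ) ≠ k + 1 from fun h => hb (Fin.ext h)]
  · simp

theorem mul_lowerShift_apply_last (M : Matrix (Fin n) (Fin n) R) (i k : Fin n)
    (hk : (k : ℕ) + 1 = n) : (M * lowerShift R n) i k = 0 := by
  simp [mul_apply, lowerShift, hk, fun x : Fin n => x.isLt.ne]

theorem apply_succ_succ_of_commute_lowerShift {M : Matrix (Fin n) (Fin n) R}
    (h : Commute M (lowerShift R n)) (i j : Fin n) (hi : (i : ℕ) + 1 < n)
    (hj : (j : ℕ) + 1 < n) : M ⟨i + 1, hi⟩ ⟨j + 1, hj⟩ = M i j := by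
  rw [← mul_lowerShift_apply M ⟨i + 1, hi⟩ j hj, h.eq, lowerShift_mul_apply_succ]

theorem apply_eq_zero_of_commute_lowerShift {M : Matrix (Fin n) (Fin n) R}
    (h : Commute M (lowerShift R n)) {i j : Fin n} (hij : i < j) : M i j = 0 := by
  obtain ⟨i, hi⟩ := i
  obtain ⟨j, hj⟩ := j
  obtain ⟨j, rfl⟩ : ∃ k, j = k + 1 := Nat.exists_eq_succ_of_ne_zero (Nat.ne_zero_of_lt hij)
  have hj' : j < n := Nat.lt_of_succ_lt hj
  induction i generalizing j with
  | zero =>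
    rw [← mul_lowerShift_apply M ⟨0, hi⟩ ⟨j, hj'⟩ hj, h.eq, lowerShift_mul_apply_zero _ _ _ rfl]
  | succ i ih =>
    rw [apply_succ_succ_of_commute_lowerShift h ⟨i, by lia⟩ ⟨j, hj'⟩]
    have hij' : i < j := Nat.lt_of_succ_lt_succ hij
    obtain ⟨k, rfl⟩ : ∃ k, j = k + 1 := Nat.exists_eq_succ_of_ne_zero (Nat.ne_zero_of_lt hij')
    exact ih _ k hj' hij' (by lia)

end lowerShift

end Matrix

theorem lowerToeplitz_commute_lowerShift {R : Type*} [CommRing R] (n : ℕ) (Y : ℕ → R) :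
    Commute (lowerToeplitz n Y) (Matrix.lowerShift R n) := by
  ext ⟨i, hi⟩ ⟨k, hk⟩
  rcases Nat.lt_or_ge (k + 1) n with hk' | hk'
  · rw [Matrix.mul_lowerShift_apply _ _ _ hk']
    cases i with
    | zero => simp [Matrix.lowerShift_mul_apply_zero, lowerToeplitz]
    | succ i =>
      rw [Matrix.lowerShift_mul_apply_succ _ ⟨i, by lia⟩]
      simp [lowerToeplitz]
  · rw [Matrix.mul_lowerShift_apply_last _ _ _ (by simp; lia)]
    cases i with
    | zero => simp [Matrix.lowerShift_mul_apply_zero]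
    | succ i =>
      rw [Matrix.lowerShift_mul_apply_succ _ ⟨i, by lia⟩]
      simp [lowerToeplitz, show ¬ k ≤ i by lia]

/-- Cofactor identities for the lower-triangular Toeplitz matrix (used in the proof of
Lemma 2.16(1)): (a) the `(i,j)` cofactor `C_{i,j}(U)`, i.e. the `(j,i)` entry of the
adjugate, vanishes for `i > j`; (b) `C_{i,j}(U) = C_{i+1,j+1}(U)`. -/
theorem lowerToeplitz_cofactor_shift {R : Type*} [CommRing R] (n : ℕ) (Y : ℕ → R) :
    (∀ i j : Fin n, (j : ℕ) < (i : ℕ) → (lowerToeplitz n Y).adjugate j i = 0) ∧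
    (∀ (i j : Fin n) (hi : (i : ℕ) + 1 < n) (hj : (j : ℕ) + 1 < n),
      (lowerToeplitz n Y).adjugate j i
        = (lowerToeplitz n Y).adjugate ⟨(j : ℕ) + 1, hj⟩ ⟨(i : ℕ) + 1, hi⟩) := by
  have h := Matrix.commute_adjugate (lowerToeplitz_commute_lowerShift n Y)
  exact ⟨fun _ _ hij => Matrix.apply_eq_zero_of_commute_lowerShift h hij,
    fun i j hi hj => (Matrix.apply_succ_succ_of_commute_lowerShift h j i hj hi).symm⟩
end

section
/- Let p > 3 be a prime and let k be an algebraically closed field of characteristic p. For elements t_{11}, t_{12}, t_{21}, t_{22} ∈ k, the following system of equations holds: t_{11} + t_{22} = 0, t_{11}^2 + t_{12}t_{21} = 0, t_{22}^2 + t_{12}t_{21} = 0, t_{11}^p t_{21} + t_{12}^p t_{11} = 0, t_{11}^p t_{22} + t_{12}^{p+1} = 0, t_{21}^{p+1} + t_{22}^p t_{11} = 0, and t_{21}^p t_{22} + t_{22}^p t_{12} = 0, if and only if there exist t ∈ k and α ∈ k with α^{p+1} = 1 such that t_{11} = t, t_{12} = α·t, t_{21} = −α^p·t, and t_{22} = −t.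 -/
/-- Explicit solution of the defining equations (9.3.1)–(9.3.6) of Section 9: over an
algebraically closed field of characteristic `p > 3`, the system holds iff
`(t₁₁, t₁₂, t₂₁, t₂₂) = (t, αt, -αᵖt, -t)` for some `t` and some `α` with `α^(p+1) = 1`. -/
theorem superspecial_neighborhood_equations (p : ℕ) (hp : p.Prime) (hp3 : 3 < p)
    (k : Type*) [Field k] [IsAlgClosed k] [CharP k p] (t₁₁ t₁₂ t₂₁ t₂₂ : k) :
    (t₁₁ + t₂₂ = 0 ∧
     t₁₁ ^ 2 + t₁₂ * t₂₁ = 0 ∧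
     t₂₂ ^ 2 + t₁₂ * t₂₁ = 0 ∧
     t₁₁ ^ p * t₂₁ + t₁₂ ^ p * t₁₁ = 0 ∧
     t₁₁ ^ p * t₂₂ + t₁₂ ^ (p + 1) = 0 ∧
     t₂₁ ^ (p + 1) + t₂₂ ^ p * t₁₁ = 0 ∧
     t₂₁ ^ p * t₂₂ + t₂₂ ^ p * t₁₂ = 0)
    ↔ ∃ (t α : k), α ^ (p + 1) = 1 ∧
        t₁₁ = t ∧ t₁₂ = α * t ∧ t₂₁ = -(α ^ p) * t ∧ t₂₂ = -t := by
  have hodd : Odd p := hp.odd_of_ne_two (by omega)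
  constructor
  · rintro ⟨htrace, -, -, h₂₁, h₁₂, h₂₁', -⟩
    obtain rfl : t₂₂ = -t₁₁ := (neg_eq_of_add_eq_zero_right htrace).symm
    by_cases ht : t₁₁ = 0
    · subst ht
      have h₁₂_zero : t₁₂ = 0 := by simpa using h₁₂
      have h₂₁_zero : t₂₁ = 0 := by simpa using h₂₁'
      exact ⟨0, 1, by simp, rfl, by simp [h₁₂_zero], by simp [h₂₁_zero], rfl⟩
    · have htp : t₁₁ ^ p ≠ 0 := pow_ne_zero p ht
      refine ⟨t₁₁, t₁₂ / t₁₁, ?_, rfl, by field_simp, ?_, rfl⟩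
      · rw [div_pow, div_eq_one_iff_eq (pow_ne_zero _ ht)]
        linear_combination h₁₂
      · rw [div_pow]
        field_simp
        linear_combination h₂₁
  · rintro ⟨t, α, hα, rfl, rfl, rfl, rfl⟩
    have hα' : α ^ p * α = 1 := by rw [← pow_succ, hα]
    have hαp : (α ^ p) ^ (p + 1) = 1 := by rw [← pow_mul, mul_comm, pow_mul, hα, one_pow]
    have hαpp : (α ^ p) ^ p = α := by
      linear_combination α * hαp - (α ^ p) ^ p * hα'
    refine ⟨by ring, ?_, ?_, ?_, ?_, ?_, ?_⟩
    · linear_combination -t₁₁ ^ 2 * hα'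
    · linear_combination -t₁₁ ^ 2 * hα'
    · rw [mul_pow]
      ring
    · rw [mul_pow, hα]
      ring
    · rw [mul_pow, hodd.add_one.neg_pow, hαp, hodd.neg_pow]
      ring
    · rw [mul_pow, hodd.neg_pow, hodd.neg_pow, hαpp]
      ring
end
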